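/- Let T be a finite combinatorial tree and i, j any two distinct nodes. Then the Lin-Lu-Yau curvature κ^{lly}_{ij} = lim_{α→1⁻} κ^{or,α}_{ij}/(1−α) exists and equals (2/d(i,j))·(1/deg(i) + 1/deg(j) − 1). -/

import Mathlib

/-- 1-Wasserstein distance on a graph w.r.t. the shortest path metric. -/
noncomputable def W1 {V : Type*} [Fintype V] (G : SimpleGraph V) (μ ν : V → ℝ) : ℝ :=
  sInf { c : ℝ | ∃ π : V → V → ℝ, (∀ i j, 0 ≤ π i j) ∧
    (∀ j, ∑ i, π i j = μ j) ∧ (∀ i, ∑ j, π i j = ν i) ∧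
    c = ∑ i, ∑ j, π i j * (G.dist i j : ℝ) }

/-- The α-lazy random walk measure at `x`. -/
noncomputable def lazy {V : Type*} [Fintype V] [DecidableEq V] (G : SimpleGraph V)
    [DecidableRel G.Adj] (α : ℝ) (x : V) : V → ℝ :=
  fun y => if y = x then α else if G.Adj x y then (1 - α) / (G.degree x : ℝ) else 0

namespace SimpleGraph

variable {V : Type*} {G : SimpleGraph V}

/-- If all mass of `μ` may be sent through `i` to `j`, and all mass of `ν` may be fetched
from `i` through `j`, without losing optimality, then `W1` is computed by an explicit coupling. -/
lemma W1_eq_of_dist_add_dist_le [Fintype V] {μ ν : V → ℝ} {i j : V}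
    (hμ : ∀ x, 0 ≤ μ x) (hν : ∀ y, 0 ≤ ν y) (hμ1 : ∑ x, μ x = 1) (hν1 : ∑ y, ν y = 1)
    (hij : 1 ≤ μ i + ν j)
    (h : ∀ x y, μ x ≠ 0 → ν y ≠ 0 →
      G.dist x j + G.dist y i ≤ G.dist y x + G.dist i j) :
    W1 G μ ν =
      ∑ x, μ x * (G.dist x j : ℝ) + ∑ y, ν y * (G.dist y i : ℝ) - G.dist i j := by
  classical
  refine IsLeast.csInf_eq ⟨?_, ?_⟩
  · refine ⟨fun y x => (if y = j then μ x else 0) + (if x = i then ν y else 0)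
      - (if y = j then if x = i then 1 else 0 else 0), fun y x => ?_, fun x => ?_, fun y => ?_, ?_⟩
    · have := hμ x
      have := hν y
      by_cases hy : y = j <;> by_cases hx : x = i <;> simp [hy, hx] <;> subst_vars <;> linarith
    · by_cases hx : x = i <;> simp [Finset.sum_add_distrib, Finset.sum_sub_distrib, hx, hν1]
    · by_cases hy : y = j <;> simp [Finset.sum_add_distrib, Finset.sum_sub_distrib, hy, hμ1]
    · simp only [sub_mul, add_mul, Finset.sum_add_distrib, Finset.sum_sub_distrib, ite_mul,
        zero_mul, one_mul, Finset.sum_ite_eq', Finset.mem_univ, if_true]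
      have e (y : V) : (∑ x, if y = j then μ x * (G.dist y x : ℝ) else 0) =
          if y = j then ∑ x, μ x * (G.dist y x : ℝ) else 0 := by
        split_ifs <;> simp
      have e' (y : V) : (∑ x, if y = j then if x = i then (G.dist y x : ℝ) else 0 else 0) =
          if y = j then (G.dist y i : ℝ) else 0 := by
        split_ifs <;> simp
      simp only [e, e', Finset.sum_ite_eq', Finset.mem_univ, if_true, G.dist_comm (u := j)]
  · rintro c ⟨π, hπ, hπμ, hπν, rfl⟩
    have key : ∑ y, ∑ x, π y x * ((G.dist x j : ℝ) + G.dist y i - G.dist i j) ≤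
        ∑ y, ∑ x, π y x * (G.dist y x : ℝ) := by
      refine Finset.sum_le_sum fun y _ => Finset.sum_le_sum fun x _ => ?_
      have hx : π y x ≤ μ x := by
        rw [← hπμ]
        exact Finset.single_le_sum (f := fun y => π y x) (fun z _ => hπ z x) (Finset.mem_univ y)
      have hy : π y x ≤ ν y := by
        rw [← hπν]
        exact Finset.single_le_sum (f := fun x => π y x) (fun z _ => hπ y z) (Finset.mem_univ x)
      rcases (hπ y x).eq_or_lt with h0 | h0
      · simp [← h0]
      · have := h x y (by linarith) (by linarith)
        have : (G.dist x j : ℝ) + G.dist y i ≤ G.dist y x + G.dist i j := by exact_mod_cast this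
        exact mul_le_mul_of_nonneg_left (by linarith) h0.le
    refine le_of_eq_of_le ?_ key
    simp only [mul_sub, mul_add, Finset.sum_add_distrib, Finset.sum_sub_distrib, ← Finset.sum_mul,
      hπν, hν1, one_mul]
    rw [Finset.sum_comm]
    simp only [← Finset.sum_mul, hπμ]

section Lazy

variable [Fintype V] [DecidableEq V] [DecidableRel G.Adj]

lemma sum_lazy_mul (α : ℝ) (x : V) (f : V → ℝ) :
    ∑ y, lazy G α x y * f y =
      α * f x + (1 - α) / (G.degree x : ℝ) * ∑ y ∈ G.neighborFinset x, f y := by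
  have e (y : V) : lazy G α x y * f y = (if y = x then α * f y else 0) +
      if y ∈ G.neighborFinset x then (1 - α) / (G.degree x : ℝ) * f y else 0 := by
    by_cases h : y = x <;> simp [lazy, h]
  simp [e, Finset.sum_add_distrib, Finset.mul_sum, -mem_neighborFinset]

lemma sum_lazy {α : ℝ} {x : V} (hx : G.degree x ≠ 0) : ∑ y, lazy G α x y = 1 := by
  have hx' : (G.degree x : ℝ) ≠ 0 := by exact_mod_cast hx
  have := sum_lazy_mul (G := G) α x fun _ => 1
  simp only [mul_one, Finset.sum_const, card_neighborFinset_eq_degree, nsmul_eq_mul] at this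
  rw [this]
  field_simp
  ring

lemma lazy_nonneg {α : ℝ} (h0 : 0 ≤ α) (h1 : α ≤ 1) (x y : V) : 0 ≤ lazy G α x y := by
  have : 0 ≤ 1 - α := by linarith
  unfold lazy
  split_ifs <;> positivity

lemma eq_or_adj_of_lazy_ne_zero {α : ℝ} {x y : V} (h : lazy G α x y ≠ 0) :
    y = x ∨ G.Adj x y := by
  unfold lazy at h
  grind

end Lazy

lemma Connected.exists_adj_dist_add_one (hG : G.Connected) {x y : V} (h : x ≠ y) :
    ∃ w, G.Adj x w ∧ G.dist w y + 1 = G.dist x y := by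
  obtain ⟨p, hp⟩ := hG.exists_walk_length_eq_dist x y
  cases p with
  | nil => exact absurd rfl h
  | @cons _ w _ hw q =>
    refine ⟨w, hw, ?_⟩
    have h1 := G.dist_le q
    have h2 := hG.dist_triangle (u := x) (v := w) (w := y)
    rw [dist_eq_one_iff_adj.mpr hw] at h2
    rw [Walk.length_cons] at hp
    lia

lemma IsTree.eq_of_adj_of_dist_add_one (hG : G.IsTree) {x y w w' : V}
    (hw : G.Adj x w) (hw' : G.Adj x w')
    (h : G.dist w y + 1 = G.dist x y) (h' : G.dist w' y + 1 = G.dist x y) : w = w' := by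
  obtain ⟨p, hp⟩ := hG.connected.exists_walk_length_eq_dist w y
  obtain ⟨q, hq⟩ := hG.connected.exists_walk_length_eq_dist w' y
  have hp' : (Walk.cons hw p).IsPath := Walk.isPath_of_length_eq_dist _ (by simp [hp, h])
  have hq' : (Walk.cons hw' q).IsPath := Walk.isPath_of_length_eq_dist _ (by simp [hq, h'])
  have := (hG.isAcyclic.subsingleton_path x y).elim ⟨_, hp'⟩ ⟨_, hq'⟩
  simp only [Subtype.mk.injEq, Walk.cons.injEq] at this
  exact this.1

lemma IsTree.dist_add_dist_le (hG : G.IsTree) {i j x y : V} (hij : i ≠ j)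
    (hx : x = i ∨ G.Adj i x) (hy : y = j ∨ G.Adj j y) :
    G.dist x j + G.dist y i ≤ G.dist y x + G.dist i j := by
  rcases hx with rfl | hx
  · lia
  rcases hy with rfl | hy
  · rw [G.dist_comm (u := x), G.dist_comm (u := i)]
  have tri (a b c : V) : G.dist a c ≤ G.dist a b + G.dist b c := hG.connected.dist_triangle
  have comm (a b : V) : G.dist a b = G.dist b a := G.dist_comm
  have hix : G.dist i x = 1 := dist_eq_one_iff_adj.mpr hx
  obtain ⟨z, hz, hzi⟩ := hG.connected.exists_adj_dist_add_one hij.symm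
  have huniq : G.dist y x + 1 = G.dist j x → G.dist z x + 1 = G.dist j x → y = z :=
    hG.eq_of_adj_of_dist_add_one hy hz
  have h1 := hG.dist_eq_dist_add_one_of_adj j hx
  have h2 := hG.dist_eq_dist_add_one_of_adj i hy
  have h3 := hG.dist_eq_dist_add_one_of_adj x hy
  have h4 := hG.dist_eq_dist_add_one_of_adj x hz
  have := tri y x i
  have := tri z i x
  grind

lemma IsTree.sum_neighborFinset_dist (hG : G.IsTree) {i j : V} (hij : i ≠ j)
    [Fintype (G.neighborSet i)] :
    ∑ x ∈ G.neighborFinset i, (G.dist x j : ℝ) =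
      G.degree i * ((G.dist i j : ℝ) + 1) - 2 := by
  classical
  obtain ⟨z, hz, hzj⟩ := hG.connected.exists_adj_dist_add_one hij
  have e : ∀ x ∈ G.neighborFinset i,
      (G.dist x j : ℝ) = ((G.dist i j : ℝ) + 1) - if x = z then 2 else 0 := by
    intro x hx
    rw [mem_neighborFinset] at hx
    rcases eq_or_ne x z with rfl | hxz
    · rw [← hzj]
      push_cast
      simp
      ring
    · have h1 := hG.dist_eq_dist_add_one_of_adj j hx
      rw [G.dist_comm (u := j), G.dist_comm (u := j)] at h1
      rcases h1 with h1 | h1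
      · exact absurd (hG.eq_of_adj_of_dist_add_one hx hz h1.symm hzj) hxz
      · simp [h1, hxz]
  rw [Finset.sum_congr rfl e, Finset.sum_sub_distrib]
  simp [hz, mul_add]

lemma IsTree.W1_lazy [Fintype V] [DecidableEq V] [DecidableRel G.Adj] (hG : G.IsTree)
    {i j : V} (hij : i ≠ j) {α : ℝ} (h0 : 1 / 2 ≤ α) (h1 : α ≤ 1) :
    W1 G (lazy G α i) (lazy G α j) = G.dist i j -
      2 * (1 - α) * (1 / (G.degree i : ℝ) + 1 / (G.degree j : ℝ) - 1) := by
  have : Nontrivial V := ⟨i, j, hij⟩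
  have hi := (hG.connected.preconnected.degree_pos_of_nontrivial i).ne'
  have hj := (hG.connected.preconnected.degree_pos_of_nontrivial j).ne'
  rw [W1_eq_of_dist_add_dist_le (i := i) (j := j) (lazy_nonneg (by linarith) h1 i)
    (lazy_nonneg (by linarith) h1 j) (sum_lazy hi) (sum_lazy hj)
    (by simp only [lazy, if_true]; linarith)
    (fun x y hx hy => hG.dist_add_dist_le hij (eq_or_adj_of_lazy_ne_zero hx)
      (eq_or_adj_of_lazy_ne_zero hy)),
    sum_lazy_mul, sum_lazy_mul, hG.sum_neighborFinset_dist hij,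
    hG.sum_neighborFinset_dist hij.symm, G.dist_comm (u := j)]
  have hi' : (G.degree i : ℝ) ≠ 0 := by exact_mod_cast hi
  have hj' : (G.degree j : ℝ) ≠ 0 := by exact_mod_cast hj
  field_simp
  ring

end SimpleGraph

theorem stmt_14 {V : Type*} [Fintype V] [DecidableEq V] (G : SimpleGraph V)
    [DecidableRel G.Adj] (hT : G.IsTree) (i j : V) (hne : i ≠ j) :
    Filter.Tendsto
      (fun α : ℝ =>
        (1 - W1 G (lazy G α i) (lazy G α j) / (G.dist i j : ℝ)) / (1 - α))
      (nhdsWithin 1 (Set.Iio 1))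
      (nhds ((2 / (G.dist i j : ℝ)) *
        (1 / (G.degree i : ℝ) + 1 / (G.degree j : ℝ) - 1))) := by
  refine tendsto_nhds_of_eventually_eq ?_
  filter_upwards [self_mem_nhdsWithin,
    mem_nhdsWithin_of_mem_nhds (Ioi_mem_nhds (by norm_num : (1 / 2 : ℝ) < 1))] with α h1 h0
  have h1' : 1 - α ≠ 0 := (sub_pos.mpr h1).ne'
  have hd : (G.dist i j : ℝ) ≠ 0 := by
    exact_mod_cast (hT.connected.pos_dist_of_ne hne).ne'
  rw [hT.W1_lazy hne (le_of_lt h0) (le_of_lt h1)]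
  generalize 1 / (G.degree i : ℝ) + 1 / (G.degree j : ℝ) - 1 = c
  field_simp
  ring
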